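/- For the same initial Tucker tensor Y^0 = C^0 ×_{i=1}^d U_i^0 of multilinear rank (r1,…,rd), the same right-hand side F(t,Y), and the same time step from t0 to t1, one step of the nested Tucker integrator (Algorithm 1) and one step of the Tucker projector-splitting integrator of Lubich (Algorithm 2) produce the same low-rank approximation Y^1 = C^1 ×_{i=1}^d U_i^1, provided the corresponding substep differential equations are solved exactly. More precisely, for every mode i the K-step differential equations of the two algorithms are equivalent (they yield K_i^1 = K̄_i^1), the S-step differential equations are equivalent (S_i^1 = S̄_i^1), and the final L-step equation of Algorithm 1 is equivalent to the core equation of Algorithm 2 under the identification C(t) = ten_d(Lᵀ(t)). -/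

import Mathlib

open Matrix Set

namespace TuckerPaper

/-! ### Basic tensor formalism

A tensor of order `D` with dimensions `n : Fin D → ℕ` is a real-valued function on the
product index set `Idx n`.  `matr n i` is the `i`-mode matricization, `tenr n i` its
inverse (tensorization), `mlprod B` the multilinear (Tucker) product with the family of
matrices `B`, and `kronFam i B` the Kronecker product of the matrices `B j` over all
modes `j ≠ i`, indexed compatibly with the `i`-mode matricization. -/

variable {D : ℕ}

/-- Index set of a tensor with dimensions `n`. -/
abbrev Idx (n : Fin D → ℕ) : Type := (j : Fin D) → Fin (n j)

/-- Real tensors with dimensions `n`. -/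
abbrev Tensor (n : Fin D → ℕ) : Type := Idx n → ℝ

/-- Column index set of the `i`-mode matricization (all modes except `i`). -/
abbrev CIdx (n : Fin D → ℕ) (i : Fin D) : Type := (j : {j : Fin D // j ≠ i}) → Fin (n j.1)

/-- `i`-mode matricization of a tensor. -/
def matr (n : Fin D → ℕ) (i : Fin D) (X : Tensor n) : Matrix (Fin (n i)) (CIdx n i) ℝ :=
  fun k m => X (fun j => if h : j = i then Fin.cast (congrArg n h).symm k else m ⟨j, h⟩)

/-- Inverse of the `i`-mode matricization (tensorization). -/
def tenr (n : Fin D → ℕ) (i : Fin D) (M : Matrix (Fin (n i)) (CIdx n i) ℝ) : Tensor n :=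
  fun idx => M (idx i) (fun j => idx j.1)

/-- Multilinear (Tucker) product `X ×₁ B 1 ×₂ B 2 ⋯ ×_D B D`. -/
noncomputable def mlprod {n m : Fin D → ℕ} (B : ∀ j, Matrix (Fin (m j)) (Fin (n j)) ℝ)
    (X : Tensor n) : Tensor m :=
  fun idx => ∑ kk : Idx n, (∏ j, B j (idx j) (kk j)) * X kk

/-- Kronecker product of the family `B j` over all modes `j ≠ i`, with indices
ordered compatibly with the `i`-mode matricization. -/
noncomputable def kronFam {p q : Fin D → ℕ} (i : Fin D)
    (B : ∀ j, Matrix (Fin (p j)) (Fin (q j)) ℝ) : Matrix (CIdx p i) (CIdx q i) ℝ :=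
  fun a b => ∏ j, B j.1 (a j) (b j)

/-- Frobenius norm of a tensor. -/
noncomputable def tfrob {n : Fin D → ℕ} (X : Tensor n) : ℝ := Real.sqrt (∑ idx, X idx ^ 2)

/-- Frobenius norm of a matrix. -/
noncomputable def mfrob {α β : Type*} [Fintype α] [Fintype β] (A : Matrix α β ℝ) : ℝ :=
  Real.sqrt (∑ a, ∑ b, A a b ^ 2)

/-- Cast of the row index of a matrix along an equality of dimensions. -/
def rcast {a b : ℕ} (h : a = b) {c : Type*} (M : Matrix (Fin a) c ℝ) : Matrix (Fin b) c ℝ :=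
  fun x y => M (Fin.cast h.symm x) y

/-- Cast of the column index of a matrix along an equality of dimensions. -/
def ccast {a b : ℕ} (h : a = b) {c : Type*} (M : Matrix c (Fin a) ℝ) : Matrix c (Fin b) ℝ :=
  fun x y => M x (Fin.cast h.symm y)

/-- Cast of a `CIdx` column index of a matrix along a family of equalities of dimensions. -/
def cidxcast {p q : Fin D → ℕ} (i : Fin D) (h : ∀ j : Fin D, j ≠ i → p j = q j) {c : Type*}
    (M : Matrix c (CIdx p i) ℝ) : Matrix c (CIdx q i) ℝ :=
  fun x m => M x (fun j => Fin.cast (h j.1 j.2).symm (m j))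

/-- `P` is the orthogonal projection onto the column space of `A`. -/
def IsOrthProjOnto {α β : Type*} [Fintype α] [Fintype β] (P : Matrix α α ℝ)
    (A : Matrix α β ℝ) : Prop :=
  Pᵀ = P ∧ P * P = P ∧ (∀ v, P.mulVec v ∈ LinearMap.range A.mulVecLin) ∧
    ∀ v ∈ LinearMap.range A.mulVecLin, P.mulVec v = v

/-- Mixed dimensions appearing in the mode-`i` subproblem of the nested Tucker
integrator: `r j` for the already processed modes `j < i` and `n j` for the modes
`j ≥ i`. -/
def mdims (n r : Fin D → ℕ) (i : Fin D) : Fin D → ℕ := fun j => if j.1 < i.1 then r j else n j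

lemma mdims_self (n r : Fin D → ℕ) (i : Fin D) : mdims n r i i = n i := if_neg (lt_irrefl _)

lemma mdims_lt (n r : Fin D → ℕ) {i j : Fin D} (h : j.1 < i.1) : mdims n r i j = r j := if_pos h

lemma mdims_not_lt (n r : Fin D → ℕ) {i j : Fin D} (h : ¬ j.1 < i.1) : mdims n r i j = n j :=
  if_neg h

lemma lt_last_of_ne {d : ℕ} {j : Fin (d + 1)} (hj : j ≠ Fin.last d) : j.1 < (Fin.last d).1 :=
  Fin.val_lt_last hj

/-- Family of matrices realizing `X ↦ X ×_{k<i} (U k)ᵀ` as a multilinear product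
`Tensor n → Tensor (mdims n r i)`. -/
noncomputable def projFam (n r : Fin D → ℕ) (i : Fin D)
    (U : ∀ j, Matrix (Fin (n j)) (Fin (r j)) ℝ) :
    ∀ j, Matrix (Fin (mdims n r i j)) (Fin (n j)) ℝ :=
  fun j => if h : j.1 < i.1 then rcast (mdims_lt n r h).symm (U j)ᵀ
    else rcast (mdims_not_lt n r h).symm 1

/-- Family of matrices realizing `X ↦ X ×_{k<i} U k` as a multilinear product
`Tensor (mdims n r i) → Tensor n`. -/
noncomputable def liftFam (n r : Fin D → ℕ) (i : Fin D)
    (U : ∀ j, Matrix (Fin (n j)) (Fin (r j)) ℝ) :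
    ∀ j, Matrix (Fin (n j)) (Fin (mdims n r i j)) ℝ :=
  fun j => if h : j.1 < i.1 then ccast (mdims_lt n r h).symm (U j)
    else ccast (mdims_not_lt n r h).symm 1

/-- Family of matrices realizing `X ↦ X ×_{k≥i, k≠i?} ...` namely identity for `k < i`
and `U k` for `k ≥ i`, as a multilinear product `Tensor r → Tensor (mdims n r i)`. -/
noncomputable def postFam (n r : Fin D → ℕ) (i : Fin D)
    (U : ∀ j, Matrix (Fin (n j)) (Fin (r j)) ℝ) :
    ∀ j, Matrix (Fin (mdims n r i j)) (Fin (r j)) ℝ :=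
  fun j => if h : j.1 < i.1 then rcast (mdims_lt n r h).symm 1
    else rcast (mdims_not_lt n r h).symm (U j)

/-- Kronecker factor family `I_{r_k}` for `k < i` and `(U k)ᵀ` for `k > i`, used to
build the corange matrix `V_i^{0,T}` of the nested Tucker integrator. -/
noncomputable def vFam (n r : Fin D → ℕ) (i : Fin D)
    (U : ∀ j, Matrix (Fin (n j)) (Fin (r j)) ℝ) :
    ∀ j, Matrix (Fin (r j)) (Fin (mdims n r i j)) ℝ :=
  fun j => if h : j.1 < i.1 then ccast (mdims_lt n r h).symm 1
    else ccast (mdims_not_lt n r h).symm (U j)ᵀ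

/-- The matrix `V_i^{0,T} = Q_i^{0,T} (⨂_{k<i} I_{r_k} ⊗ ⨂_{k>i} (U_k^0)ᵀ)` of the
nested Tucker integrator (Algorithm 1). -/
noncomputable def VT (n r : Fin D → ℕ) (i : Fin D)
    (U : ∀ j, Matrix (Fin (n j)) (Fin (r j)) ℝ) (Q : Matrix (CIdx r i) (Fin (r i)) ℝ) :
    Matrix (Fin (r i)) (CIdx (mdims n r i) i) ℝ :=
  Qᵀ * kronFam i (vFam n r i U)

/-- The matrix `V̄_i^{0,T} = Q_i^{0,T} (⨂_{k<i} (U_k^1)ᵀ ⊗ ⨂_{k>i} (U_k^0)ᵀ)` of the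
Tucker projector-splitting integrator of Lubich (Algorithm 2). -/
noncomputable def VTbar (n r : Fin D → ℕ) (i : Fin D)
    (U1 U0 : ∀ j, Matrix (Fin (n j)) (Fin (r j)) ℝ) (Q : Matrix (CIdx r i) (Fin (r i)) ℝ) :
    Matrix (Fin (r i)) (CIdx n i) ℝ :=
  Qᵀ * kronFam i (fun j => if j.1 < i.1 then (U1 j)ᵀ else (U0 j)ᵀ)


/-! ### Helper lemmas -/

lemma aux_norm_le_tfrob {n : Fin D → ℕ} (X : Tensor n) : ‖X‖ ≤ tfrob X := by
  refine (pi_norm_le_iff_of_nonneg (Real.sqrt_nonneg _)).2 fun i => ?_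
  rw [Real.norm_eq_abs]
  apply Real.abs_le_sqrt
  exact Finset.single_le_sum (f := fun idx => X idx ^ 2) (fun _ _ => sq_nonneg _)
    (Finset.mem_univ i)

lemma aux_tfrob_le_norm {n : Fin D → ℕ} (X : Tensor n) :
    tfrob X ≤ Real.sqrt (Fintype.card (Idx n)) * ‖X‖ := by
  unfold tfrob
  rw [← Real.sqrt_sq (norm_nonneg X), ← Real.sqrt_mul (Nat.cast_nonneg _)]
  apply Real.sqrt_le_sqrt
  calc ∑ idx, X idx ^ 2 ≤ ∑ _idx : Idx n, ‖X‖ ^ 2 := by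
        apply Finset.sum_le_sum
        intro i _
        rw [← sq_abs, ← Real.norm_eq_abs]
        exact pow_le_pow_left₀ (norm_nonneg _) (norm_le_pi_norm X i) 2
    _ = _ := by simp

lemma aux_ode_vec {ι : Type*} [Fintype ι] {n : Fin D → ℕ} {t0 t1 : ℝ} (ht : t0 ≤ t1) {L : ℝ}
    {F : ℝ → Tensor n → Tensor n}
    (hLip : ∀ t ∈ Icc t0 t1, ∀ Y Y' : Tensor n, tfrob (F t Y - F t Y') ≤ L * tfrob (Y - Y'))
    (A : (ι → ℝ) →ₗ[ℝ] Tensor n) (B : Tensor n →ₗ[ℝ] (ι → ℝ))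
    (x y : ℝ → ι → ℝ) (h0 : x t0 = y t0)
    (hx : ∀ t ∈ Icc t0 t1, ∀ a,
      HasDerivWithinAt (fun s => x s a) (B (F t (A (x t))) a) (Icc t0 t1) t)
    (hy : ∀ t ∈ Icc t0 t1, ∀ a,
      HasDerivWithinAt (fun s => y s a) (B (F t (A (y t))) a) (Icc t0 t1) t) :
    x t1 = y t1 := by
  have hx' : ∀ t ∈ Icc t0 t1, HasDerivWithinAt x (B (F t (A (x t)))) (Icc t0 t1) t :=
    fun t h => hasDerivWithinAt_pi.2 (hx t h)
  have hy' : ∀ t ∈ Icc t0 t1, HasDerivWithinAt y (B (F t (A (y t)))) (Icc t0 t1) t :=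
    fun t h => hasDerivWithinAt_pi.2 (hy t h)
  let A' := LinearMap.toContinuousLinearMap A
  let B' := LinearMap.toContinuousLinearMap B
  let K : ℝ := ‖B'‖ * (|L| * (Real.sqrt (Fintype.card (Idx n)) * ‖A'‖))
  have hK : 0 ≤ K := by positivity
  have key := ODE_solution_unique_of_mem_Icc_right (E := ι → ℝ) (K := ⟨K, hK⟩)
    (v := fun t z => B (F t (A z))) (s := fun _ => univ) (f := x) (g := y) (a := t0) (b := t1)
    (fun t h => ?_) (fun t h => (hx' t h).continuousWithinAt)
    (fun t h => (hx' t (Ico_subset_Icc_self h)).mono_of_mem_nhdsWithin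
      (Icc_mem_nhdsGE_of_mem h)) (fun _ _ => mem_univ _)
    (fun t h => (hy' t h).continuousWithinAt)
    (fun t h => (hy' t (Ico_subset_Icc_self h)).mono_of_mem_nhdsWithin
      (Icc_mem_nhdsGE_of_mem h)) (fun _ _ => mem_univ _) h0
  · exact key (right_mem_Icc.2 ht)
  · refine (LipschitzWith.of_dist_le_mul fun z w => ?_).lipschitzOnWith
    rw [dist_eq_norm, dist_eq_norm, ← map_sub]
    change ‖B' _‖ ≤ K * ‖z - w‖
    calc ‖B' (F t (A z) - F t (A w))‖ ≤ ‖B'‖ * ‖F t (A z) - F t (A w)‖ := B'.le_opNorm _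
      _ ≤ ‖B'‖ * (|L| * (Real.sqrt (Fintype.card (Idx n)) * (‖A'‖ * ‖z - w‖))) := by
        gcongr
        refine (aux_norm_le_tfrob _).trans ((hLip t (Ico_subset_Icc_self h) _ _).trans ?_)
        refine mul_le_mul (le_abs_self L) ?_ (Real.sqrt_nonneg _) (abs_nonneg _)
        refine (aux_tfrob_le_norm _).trans ?_
        gcongr
        rw [← map_sub]
        exact A'.le_opNorm _
      _ = K * ‖z - w‖ := by simp only [K]; ring

lemma aux_ode_mat {α β : Type*} [Fintype α] [Fintype β] {n : Fin D → ℕ} {t0 t1 : ℝ}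
    (ht : t0 ≤ t1) {L : ℝ} {F : ℝ → Tensor n → Tensor n}
    (hLip : ∀ t ∈ Icc t0 t1, ∀ Y Y' : Tensor n, tfrob (F t Y - F t Y') ≤ L * tfrob (Y - Y'))
    (A : Matrix α β ℝ →ₗ[ℝ] Tensor n) (B : Tensor n →ₗ[ℝ] Matrix α β ℝ)
    (x y : ℝ → Matrix α β ℝ) (h0 : x t0 = y t0)
    (hx : ∀ t ∈ Icc t0 t1, ∀ a b,
      HasDerivWithinAt (fun s => x s a b) (B (F t (A (x t))) a b) (Icc t0 t1) t)
    (hy : ∀ t ∈ Icc t0 t1, ∀ a b,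
      HasDerivWithinAt (fun s => y s a b) (B (F t (A (y t))) a b) (Icc t0 t1) t) :
    x t1 = y t1 := by
  let e : (α × β → ℝ) ≃ₗ[ℝ] Matrix α β ℝ := LinearEquiv.curry ℝ ℝ α β
  have := aux_ode_vec ht hLip (A ∘ₗ e.toLinearMap) (e.symm.toLinearMap ∘ₗ B)
    (fun s => e.symm (x s)) (fun s => e.symm (y s)) (by simp only [h0])
    (fun t h a => hx t h a.1 a.2)
    (fun t h a => hy t h a.1 a.2)
  exact e.symm.injective this

lemma aux_matr_tenr (n : Fin D → ℕ) (i : Fin D) (M : Matrix (Fin (n i)) (CIdx n i) ℝ) :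
    matr n i (tenr n i M) = M := by
  ext k m
  unfold matr tenr
  congr 1
  · simp
  · funext j
    simp [j.2]

lemma aux_tenr_matr (n : Fin D → ℕ) (i : Fin D) (X : Tensor n) :
    tenr n i (matr n i X) = X := by
  funext idx
  unfold matr tenr
  refine congrArg X ?_
  funext j
  by_cases h : j = i
  · subst h; simp
  · simp [h]

lemma aux_matr_inj {n : Fin D → ℕ} (i : Fin D) {X Y : Tensor n}
    (h : matr n i X = matr n i Y) : X = Y := by
  rw [← aux_tenr_matr n i X, h, aux_tenr_matr]

lemma aux_matr_apply {n : Fin D → ℕ} (i : Fin D) (X : Tensor n) (idx : Idx n) :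
    matr n i X (idx i) (fun j => idx j.1) = X idx :=
  congrFun (aux_tenr_matr n i X) idx

lemma aux_matr_mlprod {n m : Fin D → ℕ} (i : Fin D)
    (B : ∀ j, Matrix (Fin (m j)) (Fin (n j)) ℝ) (X : Tensor n) :
    matr m i (mlprod B X) = B i * matr n i X * (kronFam i B)ᵀ := by
  rw [← aux_matr_tenr m i (B i * matr n i X * (kronFam i B)ᵀ)]
  congr 1
  funext idx
  have h1 : ∀ f : Idx n → ℝ, ∑ kk, f kk =
      ∑ p : Fin (n i) × CIdx n i, f ((Equiv.piSplitAt i fun j => Fin (n j)).symm p) :=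
    fun f => (Equiv.sum_comp _ f).symm
  have hp : ∀ kk : Idx n, ∏ j, B j (idx j) (kk j) =
      B i (idx i) (kk i) * ∏ j : {j // j ≠ i}, B j.1 (idx j.1) (kk j.1) := fun kk => by
    rw [Fintype.prod_eq_mul_prod_subtype_ne _ i]
  have hs : ∀ kk : Idx n, (∏ j, B j (idx j) (kk j)) * X kk =
      (fun p : Fin (n i) × CIdx n i => B i (idx i) p.1 * matr n i X p.1 p.2 *
        kronFam i B (fun j => idx j.1) p.2) (Equiv.piSplitAt i (fun j => Fin (n j)) kk) := by
    intro kk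
    rw [hp, ← aux_matr_apply i X kk]
    simp only [Equiv.piSplitAt_apply, kronFam]
    ring
  unfold mlprod
  simp only [hs]
  rw [Equiv.sum_comp (Equiv.piSplitAt i (fun j => Fin (n j)))
    (fun p : Fin (n i) × CIdx n i => B i (idx i) p.1 * matr n i X p.1 p.2 *
        kronFam i B (fun j => idx j.1) p.2), Fintype.sum_prod_type, Finset.sum_comm]
  simp only [tenr, Matrix.mul_apply, Matrix.transpose_apply, Finset.sum_mul]

lemma aux_kron_mul {p q s : Fin D → ℕ} (i : Fin D)
    (B : ∀ j, Matrix (Fin (p j)) (Fin (q j)) ℝ) (C : ∀ j, Matrix (Fin (q j)) (Fin (s j)) ℝ) :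
    kronFam i B * kronFam i C = kronFam i (fun j => B j * C j) := by
  ext a b
  simp only [kronFam, Matrix.mul_apply]
  rw [Finset.prod_univ_sum]
  simp only [Fintype.piFinset_univ, Finset.prod_mul_distrib]

lemma aux_kron_transpose {p q : Fin D → ℕ} (i : Fin D)
    (B : ∀ j, Matrix (Fin (p j)) (Fin (q j)) ℝ) :
    (kronFam i B)ᵀ = kronFam i (fun j => (B j)ᵀ) := rfl

lemma aux_kron_congr {p q : Fin D → ℕ} (i : Fin D)
    {B C : ∀ j, Matrix (Fin (p j)) (Fin (q j)) ℝ} (h : ∀ j, j ≠ i → B j = C j) :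
    kronFam i B = kronFam i C := by
  ext a b
  exact Finset.prod_congr rfl fun j _ => by rw [h j.1 j.2]

lemma aux_ccast_mul_rcast {a b : ℕ} (h : a = b) {c e : Type*}
    (A : Matrix c (Fin a) ℝ) (B : Matrix (Fin a) e ℝ) : ccast h A * rcast h B = A * B := by
  subst h; rfl

lemma aux_rcast_mul {a b k : ℕ} (h : a = b) {e : Type*}
    (A : Matrix (Fin a) (Fin k) ℝ) (B : Matrix (Fin k) e ℝ) :
    rcast h A * B = rcast h (A * B) := rfl

lemma aux_rcast_rcast {a b : ℕ} (h : a = b) (h' : b = a) {c : Type*}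
    (A : Matrix (Fin a) c ℝ) : rcast h' (rcast h A) = A := rfl

lemma aux_ccast_transpose {a b : ℕ} (h : a = b) {c : Type*}
    (A : Matrix c (Fin a) ℝ) : (ccast h A)ᵀ = rcast h Aᵀ := rfl

lemma aux_VTbar_congr (n r : Fin D → ℕ) (i : Fin D)
    {U1 U1b : ∀ j, Matrix (Fin (n j)) (Fin (r j)) ℝ}
    (U0 : ∀ j, Matrix (Fin (n j)) (Fin (r j)) ℝ) (Q : Matrix (CIdx r i) (Fin (r i)) ℝ)
    (h : ∀ j, j.1 < i.1 → U1 j = U1b j) : VTbar n r i U1 U0 Q = VTbar n r i U1b U0 Q := by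
  unfold VTbar
  congr 2
  funext j
  split_ifs with hj
  · rw [h j hj]
  · rfl

lemma aux_VT_proj (n r : Fin D → ℕ) (i : Fin D)
    (U1 U0 : ∀ j, Matrix (Fin (n j)) (Fin (r j)) ℝ) (Q : Matrix (CIdx r i) (Fin (r i)) ℝ) :
    VT n r i U0 Q * kronFam i (projFam n r i U1) = VTbar n r i U1 U0 Q := by
  unfold VT VTbar
  rw [Matrix.mul_assoc, aux_kron_mul]
  congr 2
  funext j
  unfold vFam projFam
  split_ifs with hj
  · rw [aux_ccast_mul_rcast, Matrix.one_mul]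
  · rw [aux_ccast_mul_rcast, Matrix.mul_one]

lemma aux_lift_transpose (n r : Fin D → ℕ) (i : Fin D)
    (U : ∀ j, Matrix (Fin (n j)) (Fin (r j)) ℝ) (j : Fin D) :
    (liftFam n r i U j)ᵀ = projFam n r i U j := by
  unfold liftFam projFam
  split_ifs with hj
  · rfl
  · rw [aux_ccast_transpose, Matrix.transpose_one]

lemma aux_proj_self (n r : Fin D → ℕ) (i : Fin D)
    (U : ∀ j, Matrix (Fin (n j)) (Fin (r j)) ℝ) :
    projFam n r i U i = rcast (mdims_self n r i).symm 1 := dif_neg (lt_irrefl _)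

lemma aux_lift_self (n r : Fin D → ℕ) (i : Fin D)
    (U : ∀ j, Matrix (Fin (n j)) (Fin (r j)) ℝ) :
    liftFam n r i U i = ccast (mdims_self n r i).symm 1 := dif_neg (lt_irrefl _)

lemma aux_rcast_matr_proj (n r : Fin D → ℕ) (i : Fin D)
    (U1 : ∀ j, Matrix (Fin (n j)) (Fin (r j)) ℝ) (X : Tensor n) :
    rcast (mdims_self n r i) (matr (mdims n r i) i (mlprod (projFam n r i U1) X)) =
      matr n i X * (kronFam i (projFam n r i U1))ᵀ := by
  rw [aux_matr_mlprod, aux_proj_self, aux_rcast_mul, Matrix.one_mul]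
  rfl

lemma aux_matr_lift (n r : Fin D → ℕ) (i : Fin D)
    (U1 : ∀ j, Matrix (Fin (n j)) (Fin (r j)) ℝ)
    (M : Matrix (Fin (n i)) (CIdx (mdims n r i) i) ℝ) :
    matr n i (mlprod (liftFam n r i U1) (tenr (mdims n r i) i
      (rcast (mdims_self n r i).symm M))) = M * kronFam i (projFam n r i U1) := by
  rw [aux_matr_mlprod, aux_matr_tenr, aux_lift_self, aux_ccast_mul_rcast, Matrix.one_mul,
    aux_kron_transpose]
  simp only [aux_lift_transpose]

/-- Equality of the arguments of `F` in the two algorithms. -/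
lemma aux_in (n r : Fin D → ℕ) (i : Fin D)
    (U1 U0 : ∀ j, Matrix (Fin (n j)) (Fin (r j)) ℝ) (Q : Matrix (CIdx r i) (Fin (r i)) ℝ)
    (K : Matrix (Fin (n i)) (Fin (r i)) ℝ) :
    mlprod (liftFam n r i U1) (tenr (mdims n r i) i
      (rcast (mdims_self n r i).symm (K * VT n r i U0 Q))) =
    tenr n i (K * VTbar n r i U1 U0 Q) := by
  apply aux_matr_inj i
  rw [aux_matr_lift, aux_matr_tenr, Matrix.mul_assoc, aux_VT_proj]

/-- Equality of the projected right-hand sides in the two algorithms. -/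
lemma aux_out (n r : Fin D → ℕ) (i : Fin D)
    (U1 U0 : ∀ j, Matrix (Fin (n j)) (Fin (r j)) ℝ) (Q : Matrix (CIdx r i) (Fin (r i)) ℝ)
    (X : Tensor n) :
    rcast (mdims_self n r i) (matr (mdims n r i) i (mlprod (projFam n r i U1) X)) *
      (VT n r i U0 Q)ᵀ = matr n i X * (VTbar n r i U1 U0 Q)ᵀ := by
  rw [aux_rcast_matr_proj, Matrix.mul_assoc, ← Matrix.transpose_mul, aux_VT_proj]

lemma aux_proj_last {d : ℕ} (n r : Fin (d + 1) → ℕ)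
    (U1 : ∀ j, Matrix (Fin (n j)) (Fin (r j)) ℝ)
    (a : CIdx r (Fin.last d)) (b : CIdx n (Fin.last d)) :
    kronFam (Fin.last d) (projFam n r (Fin.last d) U1)
      (fun j => Fin.cast (mdims_lt n r (lt_last_of_ne j.2)).symm (a j)) b =
    kronFam (Fin.last d) (fun j => (U1 j)ᵀ) a b := by
  unfold kronFam
  refine Finset.prod_congr rfl fun j _ => ?_
  unfold projFam
  rw [dif_pos (lt_last_of_ne j.2)]
  rfl

lemma aux_in_last {d : ℕ} (n r : Fin (d + 1) → ℕ)
    (U1 : ∀ j, Matrix (Fin (n j)) (Fin (r j)) ℝ)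
    (Lt : Matrix (Fin (r (Fin.last d))) (CIdx r (Fin.last d)) ℝ) :
    mlprod (liftFam n r (Fin.last d) U1)
      (tenr (mdims n r (Fin.last d)) (Fin.last d)
        (rcast (mdims_self n r (Fin.last d)).symm
          (cidxcast (Fin.last d)
            (fun j hj => (mdims_lt n r (lt_last_of_ne hj)).symm)
            (U1 (Fin.last d) * Lt)))) =
    mlprod U1 (tenr r (Fin.last d) Lt) := by
  apply aux_matr_inj (Fin.last d)
  rw [aux_matr_lift, aux_matr_mlprod, aux_matr_tenr]
  ext a b
  rw [Matrix.mul_apply, Matrix.mul_apply]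
  let e : CIdx r (Fin.last d) ≃ CIdx (mdims n r (Fin.last d)) (Fin.last d) :=
    Equiv.piCongrRight fun j => finCongr (mdims_lt n r (lt_last_of_ne j.2)).symm
  rw [← Equiv.sum_comp e]
  refine Finset.sum_congr rfl fun c _ => ?_
  have := aux_proj_last n r U1 c b
  exact congrArg₂ (· * ·) rfl this

lemma aux_out_last {d : ℕ} (n r : Fin (d + 1) → ℕ)
    (U1 : ∀ j, Matrix (Fin (n j)) (Fin (r j)) ℝ) (X : Tensor n) :
    cidxcast (Fin.last d) (fun j hj => mdims_lt n r (lt_last_of_ne hj))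
      ((U1 (Fin.last d))ᵀ * rcast (mdims_self n r (Fin.last d))
        (matr (mdims n r (Fin.last d)) (Fin.last d)
          (mlprod (projFam n r (Fin.last d) U1) X))) =
    matr r (Fin.last d) (mlprod (fun j => (U1 j)ᵀ) X) := by
  rw [aux_rcast_matr_proj, aux_matr_mlprod, ← Matrix.mul_assoc]
  ext a b
  unfold cidxcast
  rw [Matrix.mul_apply, Matrix.mul_apply]
  refine Finset.sum_congr rfl fun c _ => ?_
  rw [Matrix.transpose_apply, Matrix.transpose_apply, aux_proj_last]

/-- `matr` as a linear map. -/
def auxMatrL (n : Fin D → ℕ) (i : Fin D) :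
    Tensor n →ₗ[ℝ] Matrix (Fin (n i)) (CIdx n i) ℝ where
  toFun := matr n i
  map_add' _ _ := rfl
  map_smul' _ _ := rfl

/-- `tenr` as a linear map. -/
def auxTenrL (n : Fin D → ℕ) (i : Fin D) :
    Matrix (Fin (n i)) (CIdx n i) ℝ →ₗ[ℝ] Tensor n where
  toFun := tenr n i
  map_add' _ _ := rfl
  map_smul' _ _ := rfl

/-- Two-sided matrix multiplication as a linear map. -/
def auxMulL {α β γ δ : Type*} [Fintype β] [Fintype γ]
    (A : Matrix α β ℝ) (B : Matrix γ δ ℝ) : Matrix β γ ℝ →ₗ[ℝ] Matrix α δ ℝ where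
  toFun M := A * M * B
  map_add' _ _ := by rw [Matrix.mul_add, Matrix.add_mul]
  map_smul' _ _ := by rw [Matrix.mul_smul, Matrix.smul_mul]; rfl

lemma auxMatrL_apply (n : Fin D → ℕ) (i : Fin D) (X : Tensor n) :
    auxMatrL n i X = matr n i X := rfl

lemma auxTenrL_apply (n : Fin D → ℕ) (i : Fin D) (M : Matrix (Fin (n i)) (CIdx n i) ℝ) :
    auxTenrL n i M = tenr n i M := rfl

lemma auxMulL_apply {α β γ δ : Type*} [Fintype β] [Fintype γ]
    (A : Matrix α β ℝ) (B : Matrix γ δ ℝ) (M : Matrix β γ ℝ) :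
    auxMulL A B M = A * M * B := rfl

/-- `mlprod` as a linear map. -/
noncomputable def auxMlL {n m : Fin D → ℕ} (B : ∀ j, Matrix (Fin (m j)) (Fin (n j)) ℝ) :
    Tensor n →ₗ[ℝ] Tensor m where
  toFun := mlprod B
  map_add' _ _ := by
    funext idx; simp only [mlprod, Pi.add_apply, mul_add, Finset.sum_add_distrib]
  map_smul' c _ := by
    funext idx
    simp only [mlprod, Pi.smul_apply, smul_eq_mul, Finset.mul_sum, RingHom.id_apply]
    exact Finset.sum_congr rfl fun _ _ => by ring

/-- **Equivalence of the nested Tucker integrator (Algorithm 1) and of the Tucker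
projector-splitting integrator of Lubich (Algorithm 2).**  Starting from the same
Tucker tensor `Y⁰ = C⁰ ×_j U_j⁰` of multilinear rank `(r_1, …, r_d)`, with the same
(Lipschitz-continuous) right-hand side `F` and the same time step from `t0` to `t1`,
with all corresponding substep differential equations solved exactly and consistent
choices of the QR factorizations (equal matrices are given equal QR factors), the two
algorithms produce the same results in every mode — `K_i¹ = K̄_i¹`, `U_i¹ = Ū_i¹`,
`S_i¹ = S̄_i¹` — the final L-step of Algorithm 1 is equivalent to the core equation of
Algorithm 2 under the identification `C(t) = ten_d(Lᵀ(t))`, and both algorithms deliver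
the same low-rank approximation `Y¹ = C¹ ×_i U_i¹`. -/
theorem nested_tucker_equals_tucker_projector_splitting
    {d : ℕ} (n r : Fin (d + 1) → ℕ)
    (t0 t1 : ℝ) (ht : t0 ≤ t1)
    (L : ℝ)
    (F : ℝ → Tensor n → Tensor n)
    -- Lipschitz continuity of `F` (well-posedness of the substep equations)
    (hLip : ∀ t ∈ Icc t0 t1, ∀ Y Y' : Tensor n, tfrob (F t Y - F t Y') ≤ L * tfrob (Y - Y'))
    -- common initial Tucker tensor
    (C0 : Tensor r) (U0 : ∀ j, Matrix (Fin (n j)) (Fin (r j)) ℝ)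
    (hU0 : ∀ j, (U0 j)ᵀ * U0 j = 1)
    -- ===== data of one step of Algorithm 1 (nested Tucker integrator) =====
    (Ccur : Fin (d + 2) → Tensor r)
    (hC0 : Ccur 0 = C0)
    (Qm : ∀ i : Fin (d + 1), Matrix (CIdx r i) (Fin (r i)) ℝ)
    (S0m : ∀ i : Fin (d + 1), Matrix (Fin (r i)) (Fin (r i)) ℝ)
    (hQR : ∀ i : Fin (d + 1),
      (matr r i (Ccur i.castSucc))ᵀ = Qm i * (S0m i)ᵀ ∧ (Qm i)ᵀ * Qm i = 1)
    (U1 : ∀ j : Fin (d + 1), Matrix (Fin (n j)) (Fin (r j)) ℝ)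
    (Shat : ∀ i : Fin (d + 1), Matrix (Fin (r i)) (Fin (r i)) ℝ)
    (Km : ∀ i : Fin (d + 1), ℝ → Matrix (Fin (n i)) (Fin (r i)) ℝ)
    (hK0 : ∀ i, Km i t0 = U0 i * S0m i)
    (hKode : ∀ i, ∀ t ∈ Icc t0 t1, ∀ a b,
      HasDerivWithinAt (fun s => Km i s a b)
        ((rcast (mdims_self n r i) (matr (mdims n r i) i (mlprod (projFam n r i U1)
            (F t (mlprod (liftFam n r i U1) (tenr (mdims n r i) i
              (rcast (mdims_self n r i).symm (Km i t * VT n r i U0 (Qm i))))))))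
          * (VT n r i U0 (Qm i))ᵀ) a b) (Icc t0 t1) t)
    (hKQR : ∀ i, Km i t1 = U1 i * Shat i ∧ (U1 i)ᵀ * U1 i = 1)
    (Sm : ∀ i : Fin (d + 1), ℝ → Matrix (Fin (r i)) (Fin (r i)) ℝ)
    (hS0 : ∀ i, Sm i t0 = Shat i)
    (hSode : ∀ i, ∀ t ∈ Icc t0 t1, ∀ a b,
      HasDerivWithinAt (fun s => Sm i s a b)
        ((-((U1 i)ᵀ * (rcast (mdims_self n r i) (matr (mdims n r i) i
            (mlprod (projFam n r i U1)
              (F t (mlprod (liftFam n r i U1) (tenr (mdims n r i) i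
                (rcast (mdims_self n r i).symm (U1 i * Sm i t * VT n r i U0 (Qm i))))))))
          * (VT n r i U0 (Qm i))ᵀ))) a b) (Icc t0 t1) t)
    (hCup : ∀ i : Fin (d + 1), Ccur i.succ = tenr r i (Sm i t1 * (Qm i)ᵀ))
    (Lt : ℝ → Matrix (Fin (r (Fin.last d))) (CIdx r (Fin.last d)) ℝ)
    (hL0 : Lt t0 = matr r (Fin.last d) (Ccur (Fin.last (d + 1))))
    (hLode : ∀ t ∈ Icc t0 t1, ∀ a b,
      HasDerivWithinAt (fun s => Lt s a b)
        ((cidxcast (Fin.last d) (fun j hj => mdims_lt n r (lt_last_of_ne hj))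
          ((U1 (Fin.last d))ᵀ * rcast (mdims_self n r (Fin.last d))
            (matr (mdims n r (Fin.last d)) (Fin.last d)
              (mlprod (projFam n r (Fin.last d) U1)
                (F t (mlprod (liftFam n r (Fin.last d) U1)
                  (tenr (mdims n r (Fin.last d)) (Fin.last d)
                    (rcast (mdims_self n r (Fin.last d)).symm
                      (cidxcast (Fin.last d)
                        (fun j hj => (mdims_lt n r (lt_last_of_ne hj)).symm)
                        (U1 (Fin.last d) * Lt t)))))))))) a b) (Icc t0 t1) t)
    -- ===== data of one step of Algorithm 2 (Tucker integrator of Lubich 2015) =====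
    (Cbar : Fin (d + 2) → Tensor r)
    (hCb0 : Cbar 0 = C0)
    (Qbm : ∀ i : Fin (d + 1), Matrix (CIdx r i) (Fin (r i)) ℝ)
    (S0bm : ∀ i : Fin (d + 1), Matrix (Fin (r i)) (Fin (r i)) ℝ)
    (hQRb : ∀ i : Fin (d + 1),
      (matr r i (Cbar i.castSucc))ᵀ = Qbm i * (S0bm i)ᵀ ∧ (Qbm i)ᵀ * Qbm i = 1)
    (U1b : ∀ j : Fin (d + 1), Matrix (Fin (n j)) (Fin (r j)) ℝ)
    (Shatb : ∀ i : Fin (d + 1), Matrix (Fin (r i)) (Fin (r i)) ℝ)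
    (Kbm : ∀ i : Fin (d + 1), ℝ → Matrix (Fin (n i)) (Fin (r i)) ℝ)
    (hKb0 : ∀ i, Kbm i t0 = U0 i * S0bm i)
    (hKbode : ∀ i, ∀ t ∈ Icc t0 t1, ∀ a b,
      HasDerivWithinAt (fun s => Kbm i s a b)
        ((matr n i (F t (tenr n i (Kbm i t * VTbar n r i U1b U0 (Qbm i))))
          * (VTbar n r i U1b U0 (Qbm i))ᵀ) a b) (Icc t0 t1) t)
    (hKbQR : ∀ i, Kbm i t1 = U1b i * Shatb i ∧ (U1b i)ᵀ * U1b i = 1)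
    (Sbm : ∀ i : Fin (d + 1), ℝ → Matrix (Fin (r i)) (Fin (r i)) ℝ)
    (hSb0 : ∀ i, Sbm i t0 = Shatb i)
    (hSbode : ∀ i, ∀ t ∈ Icc t0 t1, ∀ a b,
      HasDerivWithinAt (fun s => Sbm i s a b)
        ((-((U1b i)ᵀ
            * (matr n i (F t (tenr n i (U1b i * Sbm i t * VTbar n r i U1b U0 (Qbm i))))
          * (VTbar n r i U1b U0 (Qbm i))ᵀ))) a b) (Icc t0 t1) t)
    (hCbup : ∀ i : Fin (d + 1), Cbar i.succ = tenr r i (Sbm i t1 * (Qbm i)ᵀ))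
    -- core equation of Algorithm 2:  Ċ(t) = F(t, C(t) ×_i U_i¹) ×_i (U_i¹)ᵀ
    (Cf : ℝ → Tensor r)
    (hCf0 : Cf t0 = Cbar (Fin.last (d + 1)))
    (hCfode : ∀ t ∈ Icc t0 t1, ∀ idx,
      HasDerivWithinAt (fun s => Cf s idx)
        ((mlprod (fun j => (U1b j)ᵀ) (F t (mlprod U1b (Cf t)))) idx) (Icc t0 t1) t)
    -- ===== consistent choices of the (non-unique) QR factorizations =====
    (hcoupleQR : ∀ i : Fin (d + 1), Ccur i.castSucc = Cbar i.castSucc →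
      Qm i = Qbm i ∧ S0m i = S0bm i)
    (hcoupleU : ∀ i : Fin (d + 1), Km i t1 = Kbm i t1 →
      U1 i = U1b i ∧ Shat i = Shatb i) :
    -- ===== the two algorithms are equivalent =====
    (∀ i, Km i t1 = Kbm i t1) ∧
    (∀ i, U1 i = U1b i) ∧
    (∀ i, Sm i t1 = Sbm i t1) ∧
    tenr r (Fin.last d) (Lt t1) = Cf t1 ∧
    mlprod U1 (tenr r (Fin.last d) (Lt t1)) = mlprod U1b (Cf t1) := by
  have step : ∀ i : Fin (d + 1), (∀ j : Fin (d + 1), j.1 < i.1 → U1 j = U1b j) →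
      Ccur i.castSucc = Cbar i.castSucc →
      Km i t1 = Kbm i t1 ∧ U1 i = U1b i ∧ Sm i t1 = Sbm i t1 ∧ Ccur i.succ = Cbar i.succ := by
    intro i hlt hC
    obtain ⟨hQ, hS⟩ := hcoupleQR i hC
    have hV := aux_VTbar_congr n r i U0 (Qbm i) hlt
    have hK : Km i t1 = Kbm i t1 := by
      refine aux_ode_mat ht hLip
        (auxTenrL n i ∘ₗ auxMulL (1 : Matrix (Fin (n i)) (Fin (n i)) ℝ)
          (VTbar n r i U1b U0 (Qbm i)))
        (auxMulL (1 : Matrix (Fin (n i)) (Fin (n i)) ℝ) (VTbar n r i U1b U0 (Qbm i))ᵀ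
          ∘ₗ auxMatrL n i)
        (Km i) (Kbm i) (by rw [hK0, hKb0, hS]) (fun t h a b => ?_) (fun t h a b => ?_)
      · have := hKode i t h a b
        rw [aux_in, aux_out, hQ, hV] at this
        simpa only [LinearMap.comp_apply, auxTenrL_apply, auxMatrL_apply, auxMulL_apply,
          Matrix.one_mul] using this
      · simpa only [LinearMap.comp_apply, auxTenrL_apply, auxMatrL_apply, auxMulL_apply,
          Matrix.one_mul] using hKbode i t h a b
    obtain ⟨hU, hSh⟩ := hcoupleU i hK
    have hSS : Sm i t1 = Sbm i t1 := by
      refine aux_ode_mat ht hLip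
        (auxTenrL n i ∘ₗ auxMulL (U1b i) (VTbar n r i U1b U0 (Qbm i)))
        (auxMulL (-(U1b i)ᵀ) (VTbar n r i U1b U0 (Qbm i))ᵀ ∘ₗ auxMatrL n i)
        (Sm i) (Sbm i) (by rw [hS0, hSb0, hSh]) (fun t h a b => ?_) (fun t h a b => ?_)
      · have := hSode i t h a b
        rw [aux_in, aux_out, hQ, hV, hU] at this
        simpa only [LinearMap.comp_apply, auxTenrL_apply, auxMatrL_apply, auxMulL_apply,
          Matrix.neg_mul, Matrix.mul_assoc] using this
      · simpa only [LinearMap.comp_apply, auxTenrL_apply, auxMatrL_apply, auxMulL_apply,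
          Matrix.neg_mul, Matrix.mul_assoc] using hSbode i t h a b
    exact ⟨hK, hU, hSS, by rw [hCup, hCbup, hSS, hQ]⟩
  have main : ∀ k : ℕ, ∀ hk : k < d + 2, (∀ j : Fin (d + 1), j.1 < k →
      Km j t1 = Kbm j t1 ∧ U1 j = U1b j ∧ Sm j t1 = Sbm j t1) ∧
      Ccur ⟨k, hk⟩ = Cbar ⟨k, hk⟩ := by
    intro k
    induction k with
    | zero => exact fun _ => ⟨fun j hj => absurd hj (Nat.not_lt_zero _), hC0.trans hCb0.symm⟩
    | succ k ih =>
      intro hk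
      obtain ⟨h1, h2⟩ := ih (by omega)
      obtain ⟨a1, a2, a3, a4⟩ := step ⟨k, by omega⟩ (fun j hj => (h1 j hj).2.1) h2
      refine ⟨fun j hj => ?_, a4⟩
      rcases Nat.lt_succ_iff_lt_or_eq.1 hj with h | h
      · exact h1 j h
      · have hjk : j = ⟨k, Nat.lt_of_succ_lt_succ hk⟩ := Fin.ext h
        rw [hjk]
        exact ⟨a1, a2, a3⟩
  obtain ⟨hall, hC⟩ := main (d + 1) (by omega)
  have hU : U1 = U1b := funext fun j => (hall j j.2).2.1
  have hLC : tenr r (Fin.last d) (Lt t1) = Cf t1 := by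
    refine aux_ode_vec ht hLip (auxMlL U1b) (auxMlL fun j => (U1b j)ᵀ)
      (fun s => tenr r (Fin.last d) (Lt s)) Cf ?_ (fun t h idx => ?_) hCfode
    · simp only [hL0, aux_tenr_matr, hCf0]
      exact hC
    · have := hLode t h (idx (Fin.last d)) (fun j => idx j.1)
      rw [aux_in_last, aux_out_last, aux_matr_apply, hU] at this
      exact this
  exact ⟨fun i => (hall i i.2).1, fun i => (hall i i.2).2.1, fun i => (hall i i.2).2.2, hLC,
    by rw [hLC, hU]⟩

end TuckerPaper
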